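/- arXiv:1209.4396 — 2 statements merged into one kernel-verified Lean document; each statement's English description precedes it below -/
import Mathlib

section
/- Let ℓ be an odd prime, p a prime with p ≠ ℓ, n ≥ 1, and F a finite field with |F| = p^n. Write p^n − 1 = ℓ^(λ⁻) · ω⁻ and p^n + 1 = ℓ^(λ⁺) · ω⁺ with ℓ ∤ ω⁻, ℓ ∤ ω⁺, set λ_m = max(λ⁻, λ⁺), and suppose λ_m > 0; let ω_m be the one of ω⁻, ω⁺ for which ℓ^(λ_m) · ω_m ∈ {p^n − 1, p^n + 1}. Then for every k with 1 ≤ k ≤ λ_m, the number of elements a ∈ F whose preperiod under the map f : F → F, f(x) = T_ℓ(x), equals k is (ℓ − 1) · ℓ^(k−1) · ω_m / 2. -/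
open Polynomial Function

/-- The preperiod of `a` under `f` : the least `ρ ≥ 0` such that `f^[ρ] a` is a
periodic point of `f`. -/
noncomputable def preperiod {S : Type*} (f : S → S) (a : S) : ℕ :=
  sInf {ρ : ℕ | f^[ρ] a ∈ Function.periodicPts f}

/-- Two nonzero elements have the same image under `z ↦ z + z⁻¹` exactly when they are equal or
mutually inverse. -/
lemma add_inv_eq_add_inv_iff {K : Type*} [Field K] {u v : K} (hu : u ≠ 0) (hv : v ≠ 0) :
    u + u⁻¹ = v + v⁻¹ ↔ u = v ∨ u = v⁻¹ := by
  constructor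
  · intro h
    have h1 : (u - v) * (u * v - 1) = 0 := by
      field_simp at h
      linear_combination h
    rcases mul_eq_zero.mp h1 with h2 | h2
    · exact Or.inl (sub_eq_zero.mp h2)
    · exact Or.inr (eq_inv_of_mul_eq_one_left (sub_eq_zero.mp h2))
  · rintro (rfl | rfl)
    · rfl
    · rw [inv_inv, add_comm]

/-- Every element of an algebraically closed field has the form `z + z⁻¹`. -/
lemma IsAlgClosed.exists_add_inv_eq {K : Type*} [Field K] [IsAlgClosed K] (a : K) :
    ∃ z : K, z ≠ 0 ∧ z + z⁻¹ = a := by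
  have hdeg : (X ^ 2 - C a * X + 1 : K[X]).degree = 2 := by compute_degree!
  obtain ⟨z, hz⟩ := IsAlgClosed.exists_root (X ^ 2 - C a * X + 1 : K[X]) (by rw [hdeg]; decide)
  have hz' : z ^ 2 - a * z + 1 = 0 := by simpa [IsRoot] using hz
  have hz0 : z ≠ 0 := by
    rintro rfl
    simp at hz'
  refine ⟨z, hz0, ?_⟩
  field_simp
  linear_combination hz'

/-- Iterating the Dickson polynomial of degree `ℓ` on `z + z⁻¹` raises `z` to powers of `ℓ`. -/
lemma iterate_eval_dickson_add_inv {K : Type*} [Field K] (ℓ : ℕ) {z : K} (hz : z ≠ 0) (r : ℕ) :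
    (fun x : K => (dickson 1 (1 : K) ℓ).eval x)^[r] (z + z⁻¹) = z ^ ℓ ^ r + (z ^ ℓ ^ r)⁻¹ := by
  induction r with
  | zero => simp
  | succ r ih =>
    rw [Function.iterate_succ_apply', ih]
    rw [dickson_one_one_eval_add_inv _ _ (mul_inv_cancel₀ (pow_ne_zero _ hz)), inv_pow, ← pow_mul,
      ← pow_succ]

lemma algebraMap_iterate_eval_dickson {F K : Type*} [Field F] [Field K] [Algebra F K] (ℓ : ℕ)
    (r : ℕ) (a : F) :
    algebraMap F K ((fun x : F => (dickson 1 (1 : F) ℓ).eval x)^[r] a) =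
      (fun x : K => (dickson 1 (1 : K) ℓ).eval x)^[r] (algebraMap F K a) := by
  have h : Function.Semiconj (algebraMap F K) (fun x : F => (dickson 1 (1 : F) ℓ).eval x)
      (fun x : K => (dickson 1 (1 : K) ℓ).eval x) := by
    intro x
    dsimp only
    rw [← eval_map_apply, map_dickson, map_one]
  exact h.iterate_right r a

/-- An element of finite order is fixed or inverted by some power `w ↦ w ^ ℓ ^ m` exactly when its
order is prime to `ℓ`. -/
lemma exists_pow_eq_or_eq_inv_iff {K : Type*} [Field K] {ℓ : ℕ} (hℓ : ℓ.Prime) {w : K}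
    (hw : w ≠ 0) (hord : 0 < orderOf w) :
    (∃ m > 0, w ^ ℓ ^ m = w ∨ w ^ ℓ ^ m = w⁻¹) ↔ (orderOf w).Coprime ℓ := by
  constructor
  · rintro ⟨m, hm, h⟩
    rw [Nat.coprime_comm, hℓ.coprime_iff_not_dvd]
    intro hdvd
    have hpow : ℓ ∣ ℓ ^ m := dvd_pow_self ℓ hm.ne'
    have hpos : 1 ≤ ℓ ^ m := Nat.one_le_pow _ _ hℓ.pos
    apply hℓ.one_lt.ne'
    rw [← Nat.dvd_one]
    rcases h with h | h
    · have h1 : w ^ (ℓ ^ m - 1) = 1 := by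
        rw [pow_sub₀ w hw hpos, h, pow_one, mul_inv_cancel₀ hw]
      have h2 := hdvd.trans (orderOf_dvd_of_pow_eq_one h1)
      have h3 := Nat.dvd_sub hpow h2
      rwa [Nat.sub_sub_self hpos] at h3
    · have h1 : w ^ (ℓ ^ m + 1) = 1 := by
        rw [pow_succ, h, inv_mul_cancel₀ hw]
      have h2 := hdvd.trans (orderOf_dvd_of_pow_eq_one h1)
      exact (Nat.dvd_add_right hpow).mp h2
  · intro h
    refine ⟨(orderOf w).totient, Nat.totient_pos.mpr hord, Or.inl ?_⟩
    have h1 := Nat.ModEq.pow_totient h.symm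
    have h2 := pow_eq_pow_of_modEq h1 (pow_orderOf_eq_one w)
    rwa [pow_one] at h2

lemma coprime_orderOf_pow_iff {G : Type*} [Monoid G] {ℓ l w : ℕ} (hℓ : ℓ.Prime)
    (hw : ¬ ℓ ∣ w) {z : G} (hz : z ^ (ℓ ^ l * w) = 1) (r : ℕ) :
    (orderOf (z ^ ℓ ^ r)).Coprime ℓ ↔ z ^ (ℓ ^ r * w) = 1 := by
  rw [pow_mul z (ℓ ^ r) w, ← orderOf_dvd_iff_pow_eq_one]
  constructor
  · intro h
    have h1 : orderOf (z ^ ℓ ^ r) ∣ ℓ ^ l * w := by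
      apply orderOf_dvd_of_pow_eq_one
      rw [← pow_mul, mul_comm, pow_mul, hz, one_pow]
    exact (h.pow_right l).dvd_of_dvd_mul_left h1
  · intro h
    exact Nat.Coprime.coprime_dvd_left h ((hℓ.coprime_iff_not_dvd.mpr hw).symm)

/-- If `a = z + z⁻¹` with `z` of finite order, the `r`-th iterate of `a` is periodic exactly when
`z ^ ℓ ^ r` has order prime to `ℓ`. -/
lemma iterate_mem_periodicPts_iff {F K : Type*} [Field F] [Field K] [Algebra F K] {ℓ : ℕ}
    (hℓ : ℓ.Prime) {a : F} {z : K} (hord : 0 < orderOf z)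
    (ha : algebraMap F K a = z + z⁻¹) (r : ℕ) :
    (fun x : F => (dickson 1 (1 : F) ℓ).eval x)^[r] a ∈
        Function.periodicPts (fun x : F => (dickson 1 (1 : F) ℓ).eval x) ↔
      (orderOf (z ^ ℓ ^ r)).Coprime ℓ := by
  have hz : z ≠ 0 := by
    rintro rfl
    simp at hord
  have hw : z ^ ℓ ^ r ≠ 0 := pow_ne_zero _ hz
  rw [← exists_pow_eq_or_eq_inv_iff hℓ hw (orderOf_pos_iff.mpr (orderOf_pos_iff.mp hord).pow)]
  simp only [Function.mem_periodicPts, Function.IsPeriodicPt, Function.IsFixedPt]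
  refine exists_congr fun m => and_congr_right fun _ => ?_
  rw [← (algebraMap F K).injective.eq_iff, algebraMap_iterate_eval_dickson,
    algebraMap_iterate_eval_dickson, ha, iterate_eval_dickson_add_inv ℓ hz,
    iterate_eval_dickson_add_inv ℓ hw, add_inv_eq_add_inv_iff (pow_ne_zero _ hw) hw]

lemma preperiod_eq_zero_of_mem_periodicPts {S : Type*} {f : S → S} {a : S}
    (ha : a ∈ Function.periodicPts f) : preperiod f a = 0 :=
  Nat.sInf_eq_zero.mpr (Or.inl ha)

lemma preperiod_dickson_eq_succ_iff {F K : Type*} [Field F] [Field K] [Algebra F K] {ℓ l w : ℕ}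
    (hℓ : ℓ.Prime) (hw : ¬ ℓ ∣ w) {a : F} {z : K} (hz : z ^ (ℓ ^ l * w) = 1)
    (ha : algebraMap F K a = z + z⁻¹) (k : ℕ) :
    preperiod (fun x : F => (dickson 1 (1 : F) ℓ).eval x) a = k + 1 ↔
      z ^ (ℓ ^ (k + 1) * w) = 1 ∧ z ^ (ℓ ^ k * w) ≠ 1 := by
  have hw0 : 0 < w := Nat.pos_of_ne_zero fun h => hw (h ▸ dvd_zero ℓ)
  have hord : 0 < orderOf z :=
    orderOf_pos_iff.mpr
      (isOfFinOrder_iff_pow_eq_one.mpr ⟨_, Nat.mul_pos (pow_pos hℓ.pos l) hw0, hz⟩)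
  simp only [preperiod, iterate_mem_periodicPts_iff hℓ hord ha, coprime_orderOf_pow_iff hℓ hw hz]
  rw [Nat.sInf_upward_closed_eq_succ_iff]
  · rfl
  · intro i j hij hi
    simp only [Set.mem_ofPred_eq] at hi ⊢
    obtain ⟨t, rfl⟩ := Nat.exists_eq_add_of_le hij
    rw [pow_add, mul_right_comm, pow_mul, hi, one_pow]

/-- In an extension of a finite field, the solutions of `x ^ q = x` lie in the base field. -/
lemma mem_range_algebraMap_of_pow_card_eq {F K : Type*} [Field F] [Fintype F] [Field K]
    [Algebra F K] {x : K} (hx : x ^ Fintype.card F = x) : x ∈ Set.range (algebraMap F K) := by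
  have hs : (X ^ Fintype.card F - X : F[X]).Splits := by
    rw [splits_iff_card_roots, FiniteField.roots_X_pow_card_sub_X,
      FiniteField.X_pow_card_sub_X_natDegree_eq F Fintype.one_lt_card]
    rfl
  have hr := hs.roots_map (algebraMap F K)
  have hm : x ∈ ((X ^ Fintype.card F - X : F[X]).map (algebraMap F K)).roots := by
    rw [Polynomial.map_sub, Polynomial.map_pow, map_X, mem_roots
      (FiniteField.X_pow_card_sub_X_ne_zero K Fintype.one_lt_card)]
    simp [hx]
  rw [hr, Multiset.mem_map] at hm
  obtain ⟨a, -, ha⟩ := hm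
  exact ⟨a, ha⟩

/-- For `z` in an extension of `F` with `q` elements, `z + z⁻¹` lies in `F` exactly when
`z ^ (q - 1) = 1` or `z ^ (q + 1) = 1`. -/
lemma add_inv_mem_range_algebraMap_iff {F K : Type*} [Field F] [Fintype F] [Field K]
    [Algebra F K] {z : K} (hz : z ≠ 0) :
    z + z⁻¹ ∈ Set.range (algebraMap F K) ↔
      z ^ (Fintype.card F - 1) = 1 ∨ z ^ (Fintype.card F + 1) = 1 := by
  obtain ⟨p, hchar⟩ := CharP.exists F
  obtain ⟨n, hp, hcard⟩ := FiniteField.card F p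
  have : Fact p.Prime := ⟨hp⟩
  have : CharP K p := charP_of_injective_algebraMap (algebraMap F K).injective p
  have hfrob : (z + z⁻¹) ^ Fintype.card F =
      z ^ Fintype.card F + (z ^ Fintype.card F)⁻¹ := by
    rw [hcard, add_pow_char_pow, inv_pow]
  have hrange : z + z⁻¹ ∈ Set.range (algebraMap F K) ↔
      (z + z⁻¹) ^ Fintype.card F = z + z⁻¹ := by
    refine ⟨?_, mem_range_algebraMap_of_pow_card_eq⟩
    rintro ⟨a, ha⟩
    rw [← ha, ← map_pow, FiniteField.pow_card]
  rw [hrange, hfrob, add_inv_eq_add_inv_iff (pow_ne_zero _ hz) hz,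
    pow_sub₀ z hz Fintype.card_pos, pow_one, mul_inv_eq_one₀ hz, pow_succ,
    ← mul_eq_one_iff_eq_inv₀ hz]

lemma two_mul_ncard_preperiod_dickson {F : Type*} [Field F] [Fintype F] {ℓ l w N M : ℕ}
    (hℓ : ℓ.Prime) (hℓodd : Odd ℓ) (hw : ¬ ℓ ∣ w) (hN : N = ℓ ^ l * w) (hM : ¬ ℓ ∣ M)
    (hNM : (N = Fintype.card F - 1 ∧ M = Fintype.card F + 1) ∨
      (N = Fintype.card F + 1 ∧ M = Fintype.card F - 1)) {k : ℕ} (hk : k + 1 ≤ l) :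
    2 * {a : F | preperiod (fun x : F => (dickson 1 (1 : F) ℓ).eval x) a = k + 1}.ncard =
      (ℓ - 1) * ℓ ^ k * w := by
  classical
  let K := AlgebraicClosure F
  have hw0 : 0 < w := Nat.pos_of_ne_zero fun h => hw (h ▸ dvd_zero ℓ)
  have hM0 : 0 < M := Nat.pos_of_ne_zero fun h => hM (h ▸ dvd_zero ℓ)
  have hq : ((Fintype.card F : ℕ) : K) = 0 := by
    rw [← map_natCast (algebraMap F K), Nat.cast_card_eq_zero, map_zero]
  have hNK : (N : K) ≠ 0 := by
    rcases hNM with ⟨h, -⟩ | ⟨h, -⟩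
    · rw [h, Nat.cast_sub Fintype.card_pos, hq]
      simp
    · rw [h, Nat.cast_add, hq]
      simp
  have hrange : ∀ z : K, z ≠ 0 →
      (z + z⁻¹ ∈ Set.range (algebraMap F K) ↔ z ^ N = 1 ∨ z ^ M = 1) := by
    intro z hz
    rw [add_inv_mem_range_algebraMap_iff hz]
    rcases hNM with ⟨rfl, rfl⟩ | ⟨rfl, rfl⟩
    · rfl
    · exact or_comm
  have hpos : ∀ j, 0 < ℓ ^ j * w := fun j => Nat.mul_pos (pow_pos hℓ.pos j) hw0
  have hcard : ∀ j ≤ l, (nthRootsFinset (ℓ ^ j * w) (1 : K)).card = ℓ ^ j * w := by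
    intro j hj
    have : NeZero ((ℓ ^ j * w : ℕ) : K) := by
      refine ⟨fun h => hNK ?_⟩
      obtain ⟨c, hc⟩ : ℓ ^ j * w ∣ N := hN ▸ Nat.mul_dvd_mul_right (pow_dvd_pow ℓ hj) w
      rw [hc, Nat.cast_mul, h, zero_mul]
    obtain ⟨ζ, hζ⟩ := HasEnoughRootsOfUnity.exists_primitiveRoot K (ℓ ^ j * w)
    exact hζ.card_nthRootsFinset
  let B : Finset K := nthRootsFinset (ℓ ^ (k + 1) * w) 1 \ nthRootsFinset (ℓ ^ k * w) 1
  have hmemB : ∀ z : K, z ∈ B ↔ z ^ (ℓ ^ (k + 1) * w) = 1 ∧ z ^ (ℓ ^ k * w) ≠ 1 := by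
    intro z
    simp only [B, Finset.mem_sdiff, mem_nthRootsFinset (hpos _)]
  have hBcard : B.card = (ℓ - 1) * ℓ ^ k * w := by
    rw [Finset.card_sdiff_of_subset, hcard _ hk, hcard _ (by omega), ← Nat.sub_mul, pow_succ',
      Nat.sub_one_mul]
    intro z hz
    rw [mem_nthRootsFinset (hpos _)] at hz ⊢
    rw [pow_succ, mul_right_comm, pow_mul, hz, one_pow]
  have hBN : ∀ z ∈ B, z ^ N = 1 := by
    intro z hz
    obtain ⟨c, hc⟩ : ℓ ^ (k + 1) * w ∣ N := hN ▸ Nat.mul_dvd_mul_right (pow_dvd_pow ℓ hk) w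
    rw [hc, pow_mul, ((hmemB z).mp hz).1, one_pow]
  have hB0 : ∀ z ∈ B, z ≠ 0 := by
    rintro z hz rfl
    have := ((hmemB 0).mp hz).1
    rw [zero_pow (hpos _).ne'] at this
    exact zero_ne_one this
  have hBinv : ∀ z ∈ B, z⁻¹ ∈ B := by
    intro z hz
    rw [hmemB] at hz ⊢
    simpa only [inv_pow, ne_eq, inv_eq_one] using hz
  have hBne : ∀ z ∈ B, z ≠ z⁻¹ := by
    intro z hz h
    have h2 : z ^ 2 = 1 := by
      rw [pow_two]
      nth_rewrite 2 [h]
      exact mul_inv_cancel₀ (hB0 z hz)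
    obtain ⟨h1, h3⟩ := (hmemB z).mp hz
    apply h3
    obtain ⟨t, ht⟩ := hℓodd
    have hzℓ : z ^ ℓ = z := by
      rw [ht, pow_succ, pow_mul, h2, one_pow, one_mul]
    rwa [pow_succ', mul_assoc, pow_mul, hzℓ] at h1
  let A : Finset F := {a : F |
    preperiod (fun x : F => (dickson 1 (1 : F) ℓ).eval x) a = k + 1}
  have hA : ∀ a ∈ A, ∃ z ∈ B, z + z⁻¹ = algebraMap F K a := by
    intro a ha
    have ha' : preperiod (fun x : F => (dickson 1 (1 : F) ℓ).eval x) a = k + 1 := by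
      simpa [A] using ha
    obtain ⟨z, hz0, hz⟩ := IsAlgClosed.exists_add_inv_eq (algebraMap F K a)
    refine ⟨z, ?_, hz⟩
    rcases (hrange z hz0).mp ⟨a, hz.symm⟩ with h | h
    · rw [hmemB]
      exact (preperiod_dickson_eq_succ_iff hℓ hw (hN ▸ h) hz.symm k).mp ha'
    · exfalso
      have hord : 0 < orderOf z :=
        orderOf_pos_iff.mpr (isOfFinOrder_iff_pow_eq_one.mpr ⟨M, hM0, h⟩)
      have hper := (iterate_mem_periodicPts_iff hℓ hord hz.symm 0).mpr (by
        rw [pow_zero, pow_one]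
        exact Nat.Coprime.coprime_dvd_left (orderOf_dvd_of_pow_eq_one h)
          ((hℓ.coprime_iff_not_dvd.mpr hM).symm))
      rw [Function.iterate_zero_apply] at hper
      rw [preperiod_eq_zero_of_mem_periodicPts hper] at ha'
      omega
  have hBA : ∀ z ∈ B, ∃ a ∈ A, algebraMap F K a = z + z⁻¹ := by
    intro z hz
    obtain ⟨a, ha⟩ := (hrange z (hB0 z hz)).mpr (Or.inl (hBN z hz))
    refine ⟨a, ?_, ha⟩
    simpa [A] using
      (preperiod_dickson_eq_succ_iff hℓ hw (hN ▸ hBN z hz) ha k).mpr ((hmemB z).mp hz)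
  have hmaps : (B : Set K).MapsTo (fun z => z + z⁻¹) (A.image (algebraMap F K)) := by
    intro z hz
    rw [Finset.mem_coe, Finset.mem_image]
    exact hBA z hz
  have hfib : ∀ b ∈ A.image (algebraMap F K), (B.filter fun z => z + z⁻¹ = b).card = 2 := by
    intro b hb
    obtain ⟨a, ha, rfl⟩ := Finset.mem_image.mp hb
    obtain ⟨z, hz, hza⟩ := hA a ha
    rw [Finset.card_eq_two]
    refine ⟨z, z⁻¹, hBne z hz, ?_⟩
    ext y
    rw [Finset.mem_filter, Finset.mem_insert, Finset.mem_singleton, ← hza]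
    constructor
    · rintro ⟨hy, h⟩
      exact (add_inv_eq_add_inv_iff (hB0 y hy) (hB0 z hz)).mp h
    · rintro (rfl | rfl)
      · exact ⟨hz, rfl⟩
      · exact ⟨hBinv z hz, by rw [inv_inv, add_comm]⟩
  have hset : {a : F | preperiod (fun x : F => (dickson 1 (1 : F) ℓ).eval x) a = k + 1} = ↑A := by
    simp [A]
  rw [hset, Set.ncard_coe_finset, ← hBcard, Finset.card_eq_sum_card_fiberwise hmaps,
    Finset.sum_congr rfl hfib, Finset.sum_const,
    Finset.card_image_of_injective _ (algebraMap F K).injective, smul_eq_mul, mul_comm]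

/-- Let ℓ be an odd prime, p ≠ ℓ prime, F a finite field of order p^n.
Write p^n − 1 = ℓ^(λ⁻)·ω⁻ and p^n + 1 = ℓ^(λ⁺)·ω⁺ with ℓ ∤ ω⁻, ℓ ∤ ω⁺, let
λ_m = max(λ⁻, λ⁺) > 0 and ω_m be such that ℓ^(λ_m)·ω_m ∈ {p^n − 1, p^n + 1}.  Then for
every 1 ≤ k ≤ λ_m, the number of a ∈ F of preperiod k under x ↦ T_ℓ(x) equals
(ℓ − 1)·ℓ^(k−1)·ω_m/2. -/
theorem chebyshev_preperiod_count_odd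
    (ℓ p : ℕ) (hℓ : ℓ.Prime) (hℓodd : Odd ℓ) (hp : p.Prime) (hℓp : p ≠ ℓ)
    (n : ℕ) (hn : 1 ≤ n)
    (F : Type*) [Field F] [Fintype F] (hF : Fintype.card F = p ^ n)
    (lminus lplus wminus wplus : ℕ)
    (hminus : p ^ n - 1 = ℓ ^ lminus * wminus)
    (hplus : p ^ n + 1 = ℓ ^ lplus * wplus)
    (hwminus : ¬ ℓ ∣ wminus) (hwplus : ¬ ℓ ∣ wplus)
    (hlm : 0 < max lminus lplus)
    (wmax : ℕ)
    (hwmax : ℓ ^ max lminus lplus * wmax = p ^ n - 1 ∨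
             ℓ ^ max lminus lplus * wmax = p ^ n + 1) :
    ∀ k : ℕ, 1 ≤ k → k ≤ max lminus lplus →
      2 * {a : F |
            preperiod (fun x : F => (dickson 1 (1 : F) ℓ).eval x) a = k}.ncard
        = (ℓ - 1) * ℓ ^ (k - 1) * wmax := by
  intro k hk1 hk
  obtain ⟨k, rfl⟩ := Nat.exists_eq_add_of_le' hk1
  have hℓ3 : ¬ ℓ ∣ 2 := by
    intro h
    obtain ⟨t, ht⟩ := hℓodd
    have := Nat.le_of_dvd two_pos h
    have := hℓ.two_le
    omega
  have hnot : ¬ (ℓ ∣ p ^ n - 1 ∧ ℓ ∣ p ^ n + 1) := by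
    rintro ⟨h1, h2⟩
    apply hℓ3
    have h3 := Nat.dvd_sub h2 h1
    have hpos : 0 < p ^ n := pow_pos hp.pos n
    rwa [show p ^ n + 1 - (p ^ n - 1) = 2 by omega] at h3
  have hdvd : ℓ ∣ ℓ ^ max lminus lplus * wmax := (dvd_pow_self ℓ hlm.ne').mul_right wmax
  have hexp : ∀ l w : ℕ, ¬ ℓ ∣ ℓ ^ l * w → l = 0 := by
    intro l w h
    by_contra hl
    exact h ((dvd_pow_self ℓ hl).mul_right w)
  rcases hwmax with h | h
  · have hM : ¬ ℓ ∣ p ^ n + 1 := fun h2 => hnot ⟨h ▸ hdvd, h2⟩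
    have hl : lplus = 0 := hexp _ _ (hplus ▸ hM)
    rw [hl, Nat.max_zero] at h hk
    have hww : wmax = wminus :=
      Nat.eq_of_mul_eq_mul_left (pow_pos hℓ.pos lminus) (h.trans hminus)
    rw [hww]
    exact two_mul_ncard_preperiod_dickson hℓ hℓodd hwminus hminus hM
      (Or.inl ⟨by rw [hF], by rw [hF]⟩) hk
  · have hM : ¬ ℓ ∣ p ^ n - 1 := fun h2 => hnot ⟨h2, h ▸ hdvd⟩
    have hl : lminus = 0 := hexp _ _ (hminus ▸ hM)
    rw [hl, Nat.zero_max] at h hk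
    have hww : wmax = wplus :=
      Nat.eq_of_mul_eq_mul_left (pow_pos hℓ.pos lplus) (h.trans hplus)
    rw [hww]
    exact two_mul_ncard_preperiod_dickson hℓ hℓodd hwplus hplus hM
      (Or.inr ⟨by rw [hF], by rw [hF]⟩) hk
end

section
/- Let ℓ be an odd prime, p a prime with p ≠ ℓ, and t ∈ ℤ with reduction t̄ ∈ F_p. Set v = max(ν_ℓ(p − 1), ν_ℓ(p + 1)), and suppose the preperiod ρ of t̄ under the map f : F_p → F_p, f(x) = T_ℓ(x), satisfies ρ > 0. Then for every n ≥ 1: (i) if n ≤ v − ρ, the polynomial T_{ℓ^n}(X) − t̄ ∈ F_p[X] splits into a product of ℓ^n monic linear factors over F_p; (ii) if n > v − ρ, every monic irreducible factor of T_{ℓ^n}(X) − t̄ in F_p[X] has degree ℓ^(n − v + ρ). In particular, if ρ = v then T_{ℓ^n}(X) − t̄ is irreducible in F_p[X] for every n ≥ 1. -/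
open Polynomial Function

theorem dickson_one_one_monic_and_natDegree {R : Type*} [CommRing R] [IsDomain R] (n : ℕ) :
    (dickson 1 (1 : R) (n + 1)).Monic ∧ (dickson 1 (1 : R) (n + 1)).natDegree = n + 1 := by
  induction n using Nat.strong_induction_on with
  | _ n ih =>
    match n with
    | 0 => simp [monic_X]
    | n + 1 =>
      obtain ⟨hm, hd⟩ := ih n (by omega)
      have hm' : (X * dickson 1 (1 : R) (n + 1)).Monic := monic_X.mul hm
      have hd' : (X * dickson 1 (1 : R) (n + 1)).natDegree = n + 2 := by
        rw [natDegree_X_mul hm.ne_zero, hd]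
      have hlt : (dickson 1 (1 : R) n).natDegree < n + 2 := by
        rcases n with _ | n
        · have h : dickson 1 (1 : R) 0 = C 2 := by
            rw [dickson_zero, C_ofNat]; norm_num
          rw [h, natDegree_C]; omega
        · rw [(ih n (by omega)).2]; omega
      have hlt' : (dickson 1 (1 : R) n).degree < (X * dickson 1 (1 : R) (n + 1)).degree :=
        degree_lt_degree (by rw [hd']; exact hlt)
      rw [dickson_add_two, C_1, one_mul]
      exact ⟨hm'.sub_of_left hlt', by
        rw [natDegree_sub_eq_left_of_natDegree_lt (by rw [hd']; exact hlt), hd']⟩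

theorem monic_dickson_one_one_sub_C {R : Type*} [CommRing R] [IsDomain R] {n : ℕ} (hn : n ≠ 0)
    (a : R) : (dickson 1 (1 : R) n - C a).Monic := by
  obtain ⟨n, rfl⟩ := Nat.exists_eq_succ_of_ne_zero hn
  obtain ⟨hm, hd⟩ := dickson_one_one_monic_and_natDegree (R := R) n
  refine hm.sub_of_left (degree_C_le.trans_lt ?_)
  rw [degree_eq_natDegree hm.ne_zero, hd]
  exact_mod_cast Nat.succ_pos n

theorem natDegree_dickson_one_one_sub_C {R : Type*} [CommRing R] [IsDomain R] {n : ℕ} (hn : n ≠ 0)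
    (a : R) : (dickson 1 (1 : R) n - C a).natDegree = n := by
  obtain ⟨n, rfl⟩ := Nat.exists_eq_succ_of_ne_zero hn
  rw [natDegree_sub_C, (dickson_one_one_monic_and_natDegree n).2]

theorem eval_dickson_one_one_pow {R : Type*} [CommRing R] (m i : ℕ) (a : R) :
    (dickson 1 (1 : R) (m ^ i)).eval a = (fun x => (dickson 1 (1 : R) m).eval x)^[i] a := by
  induction i with
  | zero => simp
  | succ i ih =>
    rw [pow_succ', dickson_one_one_mul, eval_comp, ih, iterate_succ_apply']

section Field

variable {K : Type*} [Field K]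

theorem eval_dickson_one_one_add_inv {y : K} (hy : y ≠ 0) (m : ℕ) :
    (dickson 1 (1 : K) m).eval (y + y⁻¹) = y ^ m + (y ^ m)⁻¹ := by
  rw [dickson_one_one_eval_add_inv y y⁻¹ (mul_inv_cancel₀ hy), inv_pow]

theorem add_inv_eq_add_inv_iff_s10 {a b : K} (ha : a ≠ 0) (hb : b ≠ 0) :
    a + a⁻¹ = b + b⁻¹ ↔ a = b ∨ a = b⁻¹ := by
  constructor
  · intro h
    have h' : (a - b) * (a * b - 1) = 0 := by
      field_simp at h
      linear_combination h
    rcases mul_eq_zero.mp h' with h | h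
    · exact .inl (sub_eq_zero.mp h)
    · exact .inr (eq_inv_of_mul_eq_one_left (sub_eq_zero.mp h))
  · rintro (rfl | rfl)
    · rfl
    · rw [inv_inv, add_comm]

theorem exists_add_inv_eq [IsAlgClosed K] (x : K) : ∃ y : K, y ≠ 0 ∧ y + y⁻¹ = x := by
  have hd : (C 1 * X ^ 2 + C (-x) * X + C 1 : K[X]).degree = 2 := degree_quadratic one_ne_zero
  obtain ⟨y, hy⟩ := IsAlgClosed.exists_root (C 1 * X ^ 2 + C (-x) * X + C 1 : K[X])
    (by rw [hd]; norm_num)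
  simp only [IsRoot, eval_add, eval_mul, eval_C, eval_pow, eval_X] at hy
  have hy0 : y ≠ 0 := by
    rintro rfl
    norm_num at hy
  refine ⟨y, hy0, ?_⟩
  field_simp
  linear_combination hy

theorem pow_eq_self_or_inv_iff {y : K} (hy : y ≠ 0) {q : ℕ} :
    (y ^ q = y ∨ y ^ q = y⁻¹) ↔
      ((orderOf y : ℤ) ∣ (q : ℤ) - 1 ∨ (orderOf y : ℤ) ∣ (q : ℤ) + 1) := by
  lift y to Kˣ using IsUnit.mk0 y hy
  rw [orderOf_units, orderOf_dvd_iff_zpow_eq_one, orderOf_dvd_iff_zpow_eq_one, zpow_sub, zpow_add,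
    zpow_one, zpow_natCast, mul_inv_eq_one, mul_eq_one_iff_eq_inv, Units.ext_iff, Units.ext_iff]
  simp

theorem add_inv_pow_char_pow_eq_self_iff (p : ℕ) [Fact p.Prime] [CharP K p] {y : K} (hy : y ≠ 0)
    (d : ℕ) :
    (y + y⁻¹) ^ p ^ d = y + y⁻¹ ↔
      ((orderOf y : ℤ) ∣ (p : ℤ) ^ d - 1 ∨ (orderOf y : ℤ) ∣ (p : ℤ) ^ d + 1) := by
  rw [add_pow_char_pow, inv_pow, add_inv_eq_add_inv_iff_s10 (pow_ne_zero _ hy) hy,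
    pow_eq_self_or_inv_iff hy]
  push_cast
  rfl

end Field

theorem orderOf_eq_mul_of_prime_dvd {G : Type*} [Monoid G] {ℓ : ℕ} (hℓ : ℓ.Prime) (n : ℕ)
    (z : G) (h : ℓ ∣ orderOf (z ^ ℓ ^ n)) : orderOf z = ℓ ^ n * orderOf (z ^ ℓ ^ n) := by
  have hord := orderOf_pow' z (pow_ne_zero n hℓ.ne_zero)
  obtain ⟨j, hj, hg⟩ := (Nat.dvd_prime_pow hℓ).mp (Nat.gcd_dvd_right (orderOf z) (ℓ ^ n))
  have hmul : orderOf z = ℓ ^ j * orderOf (z ^ ℓ ^ n) := by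
    rw [hord, ← hg, Nat.mul_div_cancel' (Nat.gcd_dvd_left _ _)]
  rcases hj.eq_or_lt with rfl | hlt
  · exact hmul
  · exfalso
    have h1 : ℓ ^ (j + 1) ∣ (orderOf z).gcd (ℓ ^ n) := by
      refine Nat.dvd_gcd ?_ (pow_dvd_pow ℓ hlt)
      rw [hmul, pow_succ]
      exact Nat.mul_dvd_mul_left _ h
    rw [hg, Nat.pow_dvd_pow_iff_le_right hℓ.one_lt] at h1
    omega

/-- An element `a = y + y⁻¹` is periodic under `T_ℓ` iff `ℓ` does not divide the order of `y`. -/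
theorem add_inv_mem_periodicPts_dickson_iff {K : Type*} [Field K] {ℓ : ℕ} (hℓ : ℓ.Prime) {y : K}
    (hy : y ≠ 0) (hfin : orderOf y ≠ 0) :
    y + y⁻¹ ∈ periodicPts (fun x : K => (dickson 1 (1 : K) ℓ).eval x) ↔ ¬ ℓ ∣ orderOf y := by
  have key : ∀ k, IsPeriodicPt (fun x : K => (dickson 1 (1 : K) ℓ).eval x) k (y + y⁻¹) ↔
      ((orderOf y : ℤ) ∣ (ℓ : ℤ) ^ k - 1 ∨ (orderOf y : ℤ) ∣ (ℓ : ℤ) ^ k + 1) := by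
    intro k
    rw [IsPeriodicPt, IsFixedPt, ← eval_dickson_one_one_pow, eval_dickson_one_one_add_inv hy,
      add_inv_eq_add_inv_iff_s10 (pow_ne_zero _ hy) hy, pow_eq_self_or_inv_iff hy]
    push_cast
    rfl
  simp only [periodicPts, Set.mem_ofPred_eq, key]
  constructor
  · rintro ⟨k, hk, h⟩ hdvd
    have hd : (ℓ : ℤ) ∣ orderOf y := by exact_mod_cast hdvd
    have hp : (ℓ : ℤ) ∣ (ℓ : ℤ) ^ k := dvd_pow_self _ hk.ne'
    have h1 : (ℓ : ℤ) ∣ 1 := by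
      rcases h with h | h
      · simpa using dvd_sub hp (hd.trans h)
      · simpa using dvd_sub (hd.trans h) hp
    exact hℓ.not_dvd_one (by exact_mod_cast h1)
  · intro h
    refine ⟨(orderOf y).totient, Nat.totient_pos.mpr (Nat.pos_of_ne_zero hfin), .inl ?_⟩
    have := (Nat.ModEq.pow_totient ((Nat.Prime.coprime_iff_not_dvd hℓ).mpr h)).symm.dvd
    exact_mod_cast this

theorem mem_periodicPts_map_iff {A B : Type*} {f : A → A} {g : B → B} {φ : A → B}
    (hφ : Injective φ) (h : Semiconj φ f g) (a : A) :
    φ a ∈ periodicPts g ↔ a ∈ periodicPts f := by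
  simp only [periodicPts, Set.mem_ofPred_eq, IsPeriodicPt, IsFixedPt,
    ← (h.iterate_right _).eq, hφ.eq_iff]

/-- The preperiod of `a = y + y⁻¹` under `T_ℓ` is the exponent of `ℓ` in the order of `y`. -/
theorem preperiod_dickson_eq {k K : Type*} [Field k] [Field K] [Algebra k K] {ℓ : ℕ}
    (hℓ : ℓ.Prime) {y : K} (hy : y ≠ 0) {a : k} (ha : algebraMap k K a = y + y⁻¹) {e m : ℕ}
    (hm : ¬ ℓ ∣ m) (hord : orderOf y = ℓ ^ e * m) :
    preperiod (fun x : k => (dickson 1 (1 : k) ℓ).eval x) a = e := by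
  have hm0 : m ≠ 0 := by rintro rfl; exact hm (dvd_zero _)
  have hsemi : Semiconj (algebraMap k K) (fun x : k => (dickson 1 (1 : k) ℓ).eval x)
      (fun x : K => (dickson 1 (1 : K) ℓ).eval x) := by
    intro x
    have := map_dickson (algebraMap k K) (a := (1 : k)) (k := 1) ℓ
    rw [map_one] at this
    simp only [← this, eval_map_algebraMap, aeval_algebraMap_apply_eq_algebraMap_eval]
  have hset : {i : ℕ | (fun x : k => (dickson 1 (1 : k) ℓ).eval x)^[i] a ∈
      periodicPts (fun x : k => (dickson 1 (1 : k) ℓ).eval x)} = Set.Ici e := by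
    ext i
    have hdvd : ℓ ^ i ≠ 0 := pow_ne_zero i hℓ.ne_zero
    have h0 : orderOf (y ^ ℓ ^ i) ≠ 0 := by
      rw [orderOf_pow' y hdvd]
      exact (Nat.div_pos (Nat.gcd_le_left _ (hord ▸ by have := hℓ.pos; positivity))
        (Nat.gcd_pos_of_pos_right _ (Nat.pos_of_ne_zero hdvd))).ne'
    rw [Set.mem_ofPred_eq, Set.mem_Ici, ← mem_periodicPts_map_iff (algebraMap k K).injective hsemi,
      (hsemi.iterate_right i).eq, ha, ← eval_dickson_one_one_pow,
      eval_dickson_one_one_add_inv hy,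
      add_inv_mem_periodicPts_dickson_iff hℓ (pow_ne_zero _ hy) h0]
    constructor
    · intro h
      by_contra! hlt
      apply h
      rw [orderOf_pow_of_dvd hdvd (hord ▸ (pow_dvd_pow ℓ hlt.le).mul_right m), hord]
      obtain ⟨j, rfl⟩ := Nat.exists_eq_add_of_lt hlt
      rw [show ℓ ^ (i + j + 1) * m = ℓ ^ i * (ℓ ^ (j + 1) * m) by ring,
        Nat.mul_div_cancel_left _ (Nat.pos_of_ne_zero hdvd)]
      exact (dvd_pow_self ℓ j.succ_ne_zero).mul_right m
    · intro hle h
      refine hm (h.trans (orderOf_dvd_of_pow_eq_one ?_))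
      obtain ⟨j, rfl⟩ := Nat.exists_eq_add_of_le hle
      rw [← pow_mul, show ℓ ^ (e + j) * m = (ℓ ^ e * m) * ℓ ^ j by ring, pow_mul, ← hord,
        pow_orderOf_eq_one, one_pow]
  rw [preperiod, hset, csInf_Ici]

/-- For an odd prime `ℓ` with `ℓ ∣ p - ε`, `ε = ±1`, this determines when a number divisible by `ℓ`
whose prime-to-`ℓ` part divides `p - ε` divides `p ^ d ± 1`. -/
theorem dvd_pow_sub_one_or_dvd_pow_add_one_iff {ℓ : ℕ} (hℓ : ℓ.Prime) (hodd : Odd ℓ)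
    {P ε : ℤ} (hε : ε = 1 ∨ ε = -1) {v : ℕ} (hv : emultiplicity (ℓ : ℤ) (P - ε) = v) (hv0 : v ≠ 0)
    {a m : ℕ} (ha : a ≠ 0) (hm : ¬ ℓ ∣ m) (hmP : (m : ℤ) ∣ P - ε) (d : ℕ) :
    (((ℓ ^ a * m : ℕ) : ℤ) ∣ P ^ d - 1 ∨ ((ℓ ^ a * m : ℕ) : ℤ) ∣ P ^ d + 1) ↔
      ℓ ^ (a - v) ∣ d := by
  have hℓ2 : ¬ (ℓ : ℤ) ∣ 2 := by
    intro h
    have h2 : ℓ ∣ 2 := by exact_mod_cast h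
    rw [Nat.prime_dvd_prime_iff_eq hℓ Nat.prime_two] at h2
    subst h2
    exact absurd hodd (by decide)
  have hℓP : (ℓ : ℤ) ∣ P - ε := by
    by_contra h
    rw [emultiplicity_eq_zero.mpr h] at hv
    exact hv0 (by exact_mod_cast hv.symm)
  have hℓ1 : ¬ (ℓ : ℤ) ∣ 1 := fun h => hℓ2 (h.trans (one_dvd 2))
  have hP : ¬ (ℓ : ℤ) ∣ P := by
    intro h
    have h1 := dvd_sub h hℓP
    rw [sub_sub_cancel] at h1
    rcases hε with rfl | rfl
    · exact hℓ1 h1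
    · exact hℓ1 ((dvd_neg).mp h1)
  have hεd : ε ^ d = 1 ∨ ε ^ d = -1 := by
    rcases hε with rfl | rfl
    · exact .inl (one_pow d)
    · exact neg_one_pow_eq_or ℤ d
  have hsub : P - ε ∣ P ^ d - ε ^ d := sub_dvd_pow_sub_pow P ε d
  have hℓN : (ℓ : ℤ) ∣ ((ℓ ^ a * m : ℕ) : ℤ) := by
    exact_mod_cast (dvd_pow_self ℓ ha).mul_right m
  have hℓd := hℓP.trans hsub
  have hsign : (((ℓ ^ a * m : ℕ) : ℤ) ∣ P ^ d - 1 ∨ ((ℓ ^ a * m : ℕ) : ℤ) ∣ P ^ d + 1) ↔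
      ((ℓ ^ a * m : ℕ) : ℤ) ∣ P ^ d - ε ^ d := by
    rcases hεd with h | h <;> rw [h] at hℓd ⊢
    · refine or_iff_left fun h' => hℓ2 ?_
      have := dvd_sub (hℓN.trans h') hℓd
      ring_nf at this
      exact this
    · rw [sub_neg_eq_add] at hℓd ⊢
      refine or_iff_right fun h' => hℓ2 ?_
      have := dvd_sub hℓd (hℓN.trans h')
      ring_nf at this
      exact this
  have hcop : IsCoprime ((ℓ : ℤ) ^ a) (m : ℤ) :=
    (Nat.isCoprime_iff_coprime.mpr ((Nat.Prime.coprime_iff_not_dvd hℓ).mpr hm)).pow_left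
  have hpow : ((ℓ ^ a * m : ℕ) : ℤ) ∣ P ^ d - ε ^ d ↔ (ℓ : ℤ) ^ a ∣ P ^ d - ε ^ d := by
    push_cast
    exact ⟨fun h => (dvd_mul_right _ _).trans h, fun h => hcop.mul_dvd h (hmP.trans hsub)⟩
  rw [hsign, hpow, pow_dvd_iff_le_emultiplicity, Int.emultiplicity_pow_sub_pow hℓ hodd hℓP hP, hv,
    pow_dvd_iff_le_emultiplicity]
  push_cast
  exact tsub_le_iff_left.symm

theorem natDegree_dvd_iff_root_pow_eq_self {p : ℕ} [Fact p.Prime] {K : Type*} [Field K]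
    [Algebra (ZMod p) K] {g : (ZMod p)[X]} (hg : Irreducible g) {x : K} (hx : aeval x g = 0)
    (d : ℕ) : g.natDegree ∣ d ↔ x ^ p ^ d = x := by
  have hdvd : ∀ q : (ZMod p)[X], g ∣ q ↔ aeval x q = 0 := by
    refine fun q => ⟨fun h => aeval_eq_zero_of_dvd_aeval_eq_zero h hx, fun h => ?_⟩
    exact (Dvd.intro _ (minpoly.eq_of_irreducible hg hx)).trans (minpoly.dvd _ _ h)
  rw [hg.natDegree_dvd_iff_dvd_X_pow_card_pow_sub_X, hdvd, Nat.card_zmod]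
  simp [sub_eq_zero]

theorem exists_sign_emultiplicity_eq_max {ℓ p N : ℕ} (hℓ : ℓ.Prime) (hodd : Odd ℓ) (hp : p.Prime)
    (hℓN : ℓ ∣ N) (hN : (N : ℤ) ∣ (p : ℤ) - 1 ∨ (N : ℤ) ∣ (p : ℤ) + 1) :
    ∃ ε : ℤ, (ε = 1 ∨ ε = -1) ∧ (N : ℤ) ∣ (p : ℤ) - ε ∧
      emultiplicity (ℓ : ℤ) ((p : ℤ) - ε) =
        (max (padicValNat ℓ (p - 1)) (padicValNat ℓ (p + 1)) : ℕ) := by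
  have := Fact.mk hℓ
  have hp2 := hp.two_le
  have hsub : ((p - 1 : ℕ) : ℤ) = (p : ℤ) - 1 := by
    push_cast [Nat.cast_sub hp.one_le]; rfl
  have hadd : ((p + 1 : ℕ) : ℤ) = (p : ℤ) - (-1) := by push_cast; ring
  have hnot : ¬ (ℓ ∣ p - 1 ∧ ℓ ∣ p + 1) := by
    rintro ⟨h1, h2⟩
    have h3 := Nat.dvd_sub h2 h1
    rw [show p + 1 - (p - 1) = 2 by omega, Nat.prime_dvd_prime_iff_eq hℓ Nat.prime_two] at h3
    subst h3
    exact absurd hodd (by decide)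
  rcases hN with h | h
  · refine ⟨1, .inl rfl, h, ?_⟩
    rw [← hsub] at h ⊢
    have h1 : ℓ ∣ p - 1 := hℓN.trans (by exact_mod_cast h)
    rw [padicValNat.eq_zero_of_not_dvd fun h2 => hnot ⟨h1, h2⟩, max_eq_left (Nat.zero_le _),
      padicValNat_eq_emultiplicity (by omega), Int.natCast_emultiplicity]
  · refine ⟨-1, .inr rfl, by rwa [sub_neg_eq_add], ?_⟩
    rw [← sub_neg_eq_add, ← hadd] at h
    rw [← hadd]
    have h1 : ℓ ∣ p + 1 := hℓN.trans (by exact_mod_cast h)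
    rw [padicValNat.eq_zero_of_not_dvd fun h2 => hnot ⟨h2, h1⟩, max_eq_right (Nat.zero_le _),
      padicValNat_eq_emultiplicity (by omega), Int.natCast_emultiplicity]

/-- If `a` has positive preperiod `ρ` under `T_ℓ`, then `ρ ≤ v` and all irreducible factors of
`T_{ℓ^n} - a` have degree `ℓ ^ (n + ρ - v)` (truncated subtraction). -/
theorem natDegree_irreducible_factor_dickson {ℓ p : ℕ} (hℓ : ℓ.Prime) (hodd : Odd ℓ)
    [hp : Fact p.Prime] (a : ZMod p)
    (hpos : 0 < preperiod (fun x : ZMod p => (dickson 1 (1 : ZMod p) ℓ).eval x) a) :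
    preperiod (fun x : ZMod p => (dickson 1 (1 : ZMod p) ℓ).eval x) a ≤
        max (padicValNat ℓ (p - 1)) (padicValNat ℓ (p + 1)) ∧
      ∀ (n : ℕ) (g : (ZMod p)[X]), Irreducible g →
        g ∣ dickson 1 (1 : ZMod p) (ℓ ^ n) - C a →
        g.natDegree = ℓ ^ (n + preperiod (fun x : ZMod p => (dickson 1 (1 : ZMod p) ℓ).eval x) a -
          max (padicValNat ℓ (p - 1)) (padicValNat ℓ (p + 1))) := by
  let K := AlgebraicClosure (ZMod p)
  have : CharP K p := charP_of_injective_algebraMap (algebraMap (ZMod p) K).injective p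
  obtain ⟨y, hy, hya⟩ := exists_add_inv_eq (algebraMap (ZMod p) K a)
  have hdiv : (orderOf y : ℤ) ∣ (p : ℤ) - 1 ∨ (orderOf y : ℤ) ∣ (p : ℤ) + 1 := by
    have h := (add_inv_pow_char_pow_eq_self_iff p hy 1).mp (by
      rw [hya, pow_one, ← map_pow, ZMod.pow_card])
    simpa using h
  have hord0 : orderOf y ≠ 0 := by
    intro h0
    have := hp.out.two_le
    rw [h0] at hdiv
    rcases hdiv with h | h <;> rw [Nat.cast_zero, zero_dvd_iff] at h <;> omega
  obtain ⟨e, m, hm, hord⟩ := Nat.exists_eq_pow_mul_and_not_dvd hord0 ℓ hℓ.ne_one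
  have hρ := preperiod_dickson_eq hℓ hy hya.symm hm hord
  rw [hρ] at hpos ⊢
  have hℓN : ℓ ∣ orderOf y := hord ▸ (dvd_pow_self ℓ hpos.ne').mul_right m
  obtain ⟨ε, hε, hNε, hv⟩ := exists_sign_emultiplicity_eq_max hℓ hodd hp.out hℓN hdiv
  set v := max (padicValNat ℓ (p - 1)) (padicValNat ℓ (p + 1))
  rw [hord] at hNε
  push_cast at hNε
  have hev : e ≤ v := by
    have := pow_dvd_iff_le_emultiplicity.mp ((dvd_mul_right _ _).trans hNε)
    rw [hv] at this
    exact_mod_cast this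
  refine ⟨hev, fun n g hg hdvd => ?_⟩
  obtain ⟨x, hx⟩ := IsAlgClosed.exists_aeval_eq_zero K g (degree_pos_of_irreducible hg).ne'
  obtain ⟨z, hz, rfl⟩ := exists_add_inv_eq x
  have hroot : z ^ ℓ ^ n + (z ^ ℓ ^ n)⁻¹ = y + y⁻¹ := by
    have h := aeval_eq_zero_of_dvd_aeval_eq_zero hdvd hx
    rw [map_sub, aeval_C, sub_eq_zero, ← eval_map_algebraMap, map_dickson, map_one,
      eval_dickson_one_one_add_inv hz] at h
    rw [h, hya]
  have hordz : orderOf (z ^ ℓ ^ n) = orderOf y := by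
    rcases (add_inv_eq_add_inv_iff_s10 (pow_ne_zero _ hz) hy).mp hroot with h | h
    · rw [h]
    · rw [h]
      lift y to Kˣ using IsUnit.mk0 y hy
      rw [← Units.val_inv_eq_inv_val, orderOf_units, orderOf_units, orderOf_inv]
  have hz' : orderOf z = ℓ ^ (n + e) * m := by
    rw [orderOf_eq_mul_of_prime_dvd hℓ n z (hordz ▸ hℓN), hordz, hord, pow_add, mul_assoc]
  refine Nat.dvd_right_iff_eq.mp fun d => ?_
  rw [natDegree_dvd_iff_root_pow_eq_self hg hx, add_inv_pow_char_pow_eq_self_iff p hz, hz']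
  exact dvd_pow_sub_one_or_dvd_pow_add_one_iff hℓ hodd hε hv (by omega) (by omega) hm
    ((dvd_mul_left _ _).trans hNε) d

theorem splits_of_natDegree_irreducible_factors_eq_one {k : Type*} [Field k] {f : k[X]}
    (h : ∀ g : k[X], Irreducible g → g ∣ f → g.natDegree = 1) : f.Splits := by
  by_cases hf : f = 0
  · simp [hf]
  · obtain ⟨u, hu⟩ := UniqueFactorizationMonoid.factors_prod hf
    rw [← hu]
    refine (Splits.multisetProd fun g hg => ?_).mul u.isUnit.splits
    exact .of_natDegree_eq_one (h g (UniqueFactorizationMonoid.irreducible_of_factor g hg)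
      (UniqueFactorizationMonoid.dvd_of_mem_factors hg))

theorem exists_eq_prod_X_sub_C_fin {k : Type*} [Field k] {f : k[X]} (hs : f.Splits)
    (hm : f.Monic) {N : ℕ} (hN : f.natDegree = N) : ∃ r : Fin N → k, f = ∏ i, (X - C (r i)) := by
  subst hN
  have hlen : f.roots.toList.length = f.natDegree := by
    rw [Multiset.length_toList, hs.natDegree_eq_card_roots]
  refine ⟨fun i => f.roots.toList.get (i.cast hlen.symm), ?_⟩
  have hprod : ∏ i : Fin f.natDegree, (X - C (f.roots.toList.get (i.cast hlen.symm))) =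
      ∏ i, (X - C (f.roots.toList.get i)) :=
    Fintype.prod_equiv (finCongr hlen.symm) _ _ fun i => rfl
  rw [hprod]
  conv_lhs => rw [hs.eq_prod_roots_of_monic hm, ← Multiset.coe_toList f.roots]
  rw [Multiset.map_coe, Multiset.prod_coe, ← List.prod_ofFn]
  congr 1
  apply List.ext_get <;> simp

/-- Let ℓ be an odd prime, p ≠ ℓ prime, t̄ ∈ F_p, and set
v = max(ν_ℓ(p − 1), ν_ℓ(p + 1)).  Suppose the preperiod ρ of t̄ under x ↦ T_ℓ(x) is
positive.  Then for every n ≥ 1: (i) if n ≤ v − ρ, T_{ℓ^n}(X) − t̄ is a product of ℓ^n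
monic linear factors; (ii) if n > v − ρ, every monic irreducible factor of
T_{ℓ^n}(X) − t̄ has degree ℓ^(n−v+ρ); in particular if ρ = v then T_{ℓ^n}(X) − t̄ is
irreducible in F_p[X]. -/
theorem chebyshev_factorization_odd
    (ℓ p : ℕ) (hℓ : ℓ.Prime) (hℓodd : Odd ℓ) [hp : Fact p.Prime] (hℓp : p ≠ ℓ)
    (t : ℤ) (tbar : ZMod p) (ht : tbar = (t : ZMod p))
    (v : ℕ) (hv : v = max (padicValNat ℓ (p - 1)) (padicValNat ℓ (p + 1)))
    (ρ : ℕ)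
    (hρ : ρ = preperiod (fun x : ZMod p => (dickson 1 (1 : ZMod p) ℓ).eval x) tbar)
    (hρpos : 0 < ρ) :
    ∀ n : ℕ, 1 ≤ n →
      (n ≤ v - ρ →
        ∃ r : Fin (ℓ ^ n) → ZMod p,
          dickson 1 (1 : ZMod p) (ℓ ^ n) - C tbar = ∏ i, (X - C (r i))) ∧
      (v - ρ < n →
        ∀ g : (ZMod p)[X], g.Monic → Irreducible g →
          g ∣ dickson 1 (1 : ZMod p) (ℓ ^ n) - C tbar →
          g.natDegree = ℓ ^ (n + ρ - v)) ∧
      (ρ = v → Irreducible (dickson 1 (1 : ZMod p) (ℓ ^ n) - C tbar)) := by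
  subst hv hρ
  obtain ⟨hle, hdeg⟩ := natDegree_irreducible_factor_dickson hℓ hℓodd tbar hρpos
  intro n _
  have hN : ℓ ^ n ≠ 0 := pow_ne_zero n hℓ.ne_zero
  have hm := monic_dickson_one_one_sub_C hN tbar
  have hd := natDegree_dickson_one_one_sub_C hN tbar
  refine ⟨fun hn => ?_, fun _ g _ hg hdvd => hdeg n g hg hdvd, fun heq => ?_⟩
  · refine exists_eq_prod_X_sub_C_fin
      (splits_of_natDegree_irreducible_factors_eq_one fun g hg hdvd => ?_) hm hd
    rw [hdeg n g hg hdvd, Nat.sub_eq_zero_of_le (by omega), pow_zero]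
  · have hunit : ¬ IsUnit (dickson 1 (1 : ZMod p) (ℓ ^ n) - C tbar) := fun h =>
      hN (hd ▸ natDegree_eq_zero_of_isUnit h)
    obtain ⟨g, hg, hdvd⟩ := WfDvdMonoid.exists_irreducible_factor hunit hm.ne_zero
    have hgd := hdeg n g hg hdvd
    rw [← heq, Nat.add_sub_cancel] at hgd
    exact (associated_of_dvd_of_natDegree_le hdvd hm.ne_zero (by rw [hd, hgd])).irreducible hg
end
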